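/- Let f be a bounded solution of the capillary problem on the sector Ω that is discontinuous at O, and assume the radial limit Rf(θ) exists for every θ ∈ (−α, α). Suppose f has an increasing upper fan: there exist α₂ ∈ (−α, α] and η > 0 such that Rf is constant on [α₂, α) and strictly increasing on [α₂ − η, α₂] ∩ (−α, α); set β⁺ = α − α₂. Then for every λ ∈ (β⁺, π), A⁺_I(sin(λ − β⁺)/sin λ) + sin(β⁺)/sin λ ≥ 1. -/

import Mathlib

open Real Set Filter MeasureTheory Topology

noncomputable section

/-- The open circular sector with vertex `O = (0,0)`, half-opening angle `α`, radius `δ`. -/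
def sector (α δ : ℝ) : Set (ℝ × ℝ) :=
  {p | ∃ r θ : ℝ, 0 < r ∧ r < δ ∧ -α < θ ∧ θ < α ∧ p = (r * Real.cos θ, r * Real.sin θ)}

/-- The gradient of `f : ℝ × ℝ → ℝ`. -/
def grad (f : ℝ × ℝ → ℝ) (p : ℝ × ℝ) : ℝ × ℝ :=
  (fderiv ℝ f p (1, 0), fderiv ℝ f p (0, 1))

/-- `Tf = ∇f / √(1 + |∇f|²)`. -/
def Tf (f : ℝ × ℝ → ℝ) (p : ℝ × ℝ) : ℝ × ℝ :=
  ((grad f p).1 / Real.sqrt (1 + (grad f p).1 ^ 2 + (grad f p).2 ^ 2),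
   (grad f p).2 / Real.sqrt (1 + (grad f p).1 ^ 2 + (grad f p).2 ^ 2))

/-- `Nf = div (Tf)`. -/
def Nf (f : ℝ × ℝ → ℝ) (p : ℝ × ℝ) : ℝ :=
  fderiv ℝ (fun q => (Tf f q).1) p (1, 0) + fderiv ℝ (fun q => (Tf f q).2) p (0, 1)

/-- Euclidean dot product on `ℝ × ℝ`. -/
def dot (v w : ℝ × ℝ) : ℝ := v.1 * w.1 + v.2 * w.2

/-- `f` is a bounded solution of the capillary problem `Nf = κ f + lam₀` in the sector,
`Tf ⬝ ν = cos γ` on the two open edges, with contact angles `γp, γm : (0,δ) → [0,π]`. -/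
structure IsCapillarySolution (α δ κ lam₀ : ℝ) (γp γm : ℝ → ℝ) (f : ℝ × ℝ → ℝ) : Prop where
  measurable_γp : Measurable γp
  measurable_γm : Measurable γm
  range_γp : ∀ s ∈ Ioo (0:ℝ) δ, γp s ∈ Icc 0 π
  range_γm : ∀ s ∈ Ioo (0:ℝ) δ, γm s ∈ Icc 0 π
  bounded : ∃ M : ℝ, ∀ p ∈ sector α δ, |f p| ≤ M
  smooth : ContDiffOn ℝ 2 f (sector α δ)
  pde : ∀ p ∈ sector α δ, Nf f p = κ * f p + lam₀
  edgeP_smooth : ∀ s ∈ Ioo (0:ℝ) δ, ContDiffAt ℝ 1 f (s * Real.cos α, s * Real.sin α)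
  edgeM_smooth : ∀ s ∈ Ioo (0:ℝ) δ, ContDiffAt ℝ 1 f (s * Real.cos α, -(s * Real.sin α))
  bcP : ∀ s ∈ Ioo (0:ℝ) δ,
    dot (Tf f (s * Real.cos α, s * Real.sin α)) (-Real.sin α, Real.cos α) = Real.cos (γp s)
  bcM : ∀ s ∈ Ioo (0:ℝ) δ,
    dot (Tf f (s * Real.cos α, -(s * Real.sin α))) (-Real.sin α, -Real.cos α) = Real.cos (γm s)

/-- `L` is the radial limit `Rf(θ)` of `f` in direction `θ`. -/
def RadialLimitAt (f : ℝ × ℝ → ℝ) (θ L : ℝ) : Prop :=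
  Tendsto (fun r => f (r * Real.cos θ, r * Real.sin θ)) (𝓝[>] (0:ℝ)) (𝓝 L)

/-- `f` is discontinuous at the corner `O`: `f(x)` has no limit as `Ω ∋ x → O`. -/
def DiscontinuousAtCorner (α δ : ℝ) (f : ℝ × ℝ → ℝ) : Prop :=
  ¬ ∃ L : ℝ, Tendsto f (𝓝[sector α δ] ((0:ℝ), (0:ℝ))) (𝓝 L)

/-- `A_I(b) = liminf_{ε→0⁺} (1/ε) ∫₀^{bε} cos γ(t) dt`. -/
def fanAI (γ : ℝ → ℝ) (b : ℝ) : ℝ :=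
  liminf (fun ε : ℝ => ε⁻¹ * ∫ t in Ioo (0:ℝ) (b * ε), Real.cos (γ t)) (𝓝[>] (0:ℝ))

/-- `A_S(b) = limsup_{ε→0⁺} (1/ε) ∫₀^{bε} cos γ(t) dt`. -/
def fanAS (γ : ℝ → ℝ) (b : ℝ) : ℝ :=
  limsup (fun ε : ℝ => ε⁻¹ * ∫ t in Ioo (0:ℝ) (b * ε), Real.cos (γ t)) (𝓝[>] (0:ℝ))

def crs (v w : ℝ × ℝ) : ℝ := v.1 * w.2 - v.2 * w.1

lemma flux_identity (V : ℝ × ℝ → ℝ × ℝ) (dv : ℝ × ℝ → ℝ) (P Q : ℝ × ℝ) (a ε : ℝ) (hae : a ≤ ε)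
    (hc : ∀ s ∈ Icc a ε, ∀ t ∈ Icc (0:ℝ) 1, ContinuousAt V (s • (P + t • (Q - P))))
    (hdc : ∀ s ∈ Icc a ε, ∀ t ∈ Icc (0:ℝ) 1, ContinuousAt dv (s • (P + t • (Q - P))))
    (hd : ∀ s ∈ Ioo a ε, ∀ t ∈ Ioo (0:ℝ) 1, DifferentiableAt ℝ V (s • (P + t • (Q - P))))
    (hdiv : ∀ s ∈ Ioo a ε, ∀ t ∈ Ioo (0:ℝ) 1,
      fderiv ℝ (fun q => (V q).1) (s • (P + t • (Q - P))) (1, 0)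
      + fderiv ℝ (fun q => (V q).2) (s • (P + t • (Q - P))) (0, 1)
        = dv (s • (P + t • (Q - P)))) :
    ∫ s in a..ε, ∫ t in (0:ℝ)..1, crs P Q * s * dv (s • (P + t • (Q - P))) =
      (((∫ s in a..ε, -crs (V (s • Q)) Q) - ∫ s in a..ε, -crs (V (s • P)) P)
      + ∫ t in (0:ℝ)..1, crs (V (ε • (P + t • (Q - P)))) (ε • (Q - P)))
      - ∫ t in (0:ℝ)..1, crs (V (a • (P + t • (Q - P)))) (a • (Q - P)) := by
  classical
  set φ : ℝ × ℝ → ℝ × ℝ := fun x => x.1 • (P + x.2 • (Q - P)) with hφ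
  set F : ℝ × ℝ → ℝ := fun x => crs (V (φ x)) (x.1 • (Q - P)) with hF
  set G : ℝ × ℝ → ℝ := fun x => - crs (V (φ x)) (P + x.2 • (Q - P)) with hG
  have hφc : Continuous φ := by fun_prop
  have u1 : uIcc a ε = Icc a ε := uIcc_of_le hae
  have u2 : uIcc (0:ℝ) 1 = Icc 0 1 := uIcc_of_le zero_le_one
  have hVφ : ContinuousOn (fun x => V (φ x)) (uIcc a ε ×ˢ uIcc (0:ℝ) 1) := by
    rw [u1, u2]
    rintro x ⟨h1, h2⟩
    have := (hc x.1 h1 x.2 h2)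
    exact (ContinuousAt.comp (f := φ) (x := x) this hφc.continuousAt).continuousWithinAt
  have hdvφ : ContinuousOn (fun x => dv (φ x)) (uIcc a ε ×ˢ uIcc (0:ℝ) 1) := by
    rw [u1, u2]
    rintro x ⟨h1, h2⟩
    have := (hdc x.1 h1 x.2 h2)
    exact (ContinuousAt.comp (f := φ) (x := x) this hφc.continuousAt).continuousWithinAt
  set S : Set (ℝ × ℝ) := Ioo a ε ×ˢ Ioo (0:ℝ) 1 with hS
  have hdF : ∀ x ∈ S, DifferentiableAt ℝ F x := by
    rintro x ⟨h1, h2⟩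
    have h := hd x.1 h1 x.2 h2
    have hφd : DifferentiableAt ℝ φ x := by fun_prop
    have : DifferentiableAt ℝ (fun x => V (φ x)) x := DifferentiableAt.comp (f := φ) x h hφd
    simp only [hF, crs]
    fun_prop
  have hdG : ∀ x ∈ S, DifferentiableAt ℝ G x := by
    rintro x ⟨h1, h2⟩
    have h := hd x.1 h1 x.2 h2
    have hφd : DifferentiableAt ℝ φ x := by fun_prop
    have : DifferentiableAt ℝ (fun x => V (φ x)) x := DifferentiableAt.comp (f := φ) x h hφd
    simp only [hG, crs]
    fun_prop
  have key : ∀ x ∈ S, fderiv ℝ F x (1, 0) + fderiv ℝ G x (0, 1) = crs P Q * x.1 * dv (φ x) := by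
    rintro x hx
    obtain ⟨h1, h2⟩ := hx
    have h := hd x.1 h1 x.2 h2
    have hv := hdiv x.1 h1 x.2 h2
    change DifferentiableAt ℝ V (φ x) at h
    change fderiv ℝ (fun q => (V q).1) (φ x) (1, 0) + fderiv ℝ (fun q => (V q).2) (φ x) (0, 1)
      = dv (φ x) at hv
    have e1 : HasFDerivAt (fun q => (V q).1) (fderiv ℝ (fun q => (V q).1) (φ x)) (φ x) :=
      h.fst.hasFDerivAt
    have e2 : HasFDerivAt (fun q => (V q).2) (fderiv ℝ (fun q => (V q).2) (φ x)) (φ x) :=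
      h.snd.hasFDerivAt
    set A := fderiv ℝ (fun q => (V q).1) (φ x)
    set B := fderiv ℝ (fun q => (V q).2) (φ x)
    have hA : ∀ v : ℝ × ℝ, A v = v.1 * A (1, 0) + v.2 * A (0, 1) := by
      intro v
      have : v = v.1 • ((1:ℝ), (0:ℝ)) + v.2 • ((0:ℝ), (1:ℝ)) := by ext <;> simp
      conv_lhs => rw [this, map_add, map_smul, map_smul]
      simp
    have hB : ∀ v : ℝ × ℝ, B v = v.1 * B (1, 0) + v.2 * B (0, 1) := by
      intro v
      have : v = v.1 • ((1:ℝ), (0:ℝ)) + v.2 • ((0:ℝ), (1:ℝ)) := by ext <;> simp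
      conv_lhs => rw [this, map_add, map_smul, map_smul]
      simp
    -- s line
    have l1 : HasDerivAt (fun r : ℝ => φ (r, x.2)) (P + x.2 • (Q - P)) x.1 := by
      have := (hasDerivAt_id x.1).smul_const (P + x.2 • (Q - P))
      simpa [hφ] using this
    have l2 : HasDerivAt (fun r : ℝ => φ (x.1, r)) (x.1 • (Q - P)) x.2 := by
      have := (((hasDerivAt_id x.2).smul_const (Q - P)).const_add P).const_smul x.1
      rw [one_smul] at this
      exact this
    have F1 : fderiv ℝ F x (1, 0) = deriv (fun r => F (r, x.2)) x.1 := by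
      have := (hdF x ⟨h1, h2⟩).hasFDerivAt
      have hl : HasDerivAt (fun r : ℝ => (r, x.2)) ((1:ℝ), (0:ℝ)) x.1 :=
        (hasDerivAt_id x.1).prodMk (hasDerivAt_const _ _)
      exact (HasFDerivAt.comp_hasDerivAt (f := fun r : ℝ => (r, x.2)) x.1 this hl).deriv.symm
    have G1 : fderiv ℝ G x (0, 1) = deriv (fun r => G (x.1, r)) x.2 := by
      have := (hdG x ⟨h1, h2⟩).hasFDerivAt
      have hl : HasDerivAt (fun r : ℝ => (x.1, r)) ((0:ℝ), (1:ℝ)) x.2 :=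
        (hasDerivAt_const _ _).prodMk (hasDerivAt_id x.2)
      exact (HasFDerivAt.comp_hasDerivAt (f := fun r : ℝ => (x.1, r)) x.2 this hl).deriv.symm
    have a1 := HasFDerivAt.comp_hasDerivAt (f := fun r : ℝ => φ (r, x.2)) x.1 e1 l1
    have b1 := HasFDerivAt.comp_hasDerivAt (f := fun r : ℝ => φ (r, x.2)) x.1 e2 l1
    have a2 := HasFDerivAt.comp_hasDerivAt (f := fun r : ℝ => φ (x.1, r)) x.2 e1 l2
    have b2 := HasFDerivAt.comp_hasDerivAt (f := fun r : ℝ => φ (x.1, r)) x.2 e2 l2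
    have F2 := ((a1.mul ((hasDerivAt_id x.1).mul_const (Q - P).2)).sub
      (b1.mul ((hasDerivAt_id x.1).mul_const (Q - P).1))).deriv
    have k2 := ((hasDerivAt_id x.2).mul_const (Q - P).2).const_add P.2
    have k1 := ((hasDerivAt_id x.2).mul_const (Q - P).1).const_add P.1
    have G2 := ((a2.mul k2).sub (b2.mul k1)).neg.deriv
    have F3 : fderiv ℝ F x (1, 0) = _ := F1.trans F2
    have G3 : fderiv ℝ G x (0, 1) = _ := G1.trans G2
    rw [F3, G3, ← hv, hA (P + x.2 • (Q - P)), hB (P + x.2 • (Q - P)), hA (x.1 • (Q - P)),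
      hB (x.1 • (Q - P))]
    simp [crs]
    ring
  set F' : ℝ × ℝ → ℝ × ℝ →L[ℝ] ℝ := fun x => if x ∈ S then fderiv ℝ F x else
    (crs P Q * x.1 * dv (φ x)) • ContinuousLinearMap.fst ℝ ℝ ℝ with hF'
  set G' : ℝ × ℝ → ℝ × ℝ →L[ℝ] ℝ := fun x => if x ∈ S then fderiv ℝ G x else 0 with hG'
  have tot : ∀ x, F' x (1, 0) + G' x (0, 1) = crs P Q * x.1 * dv (φ x) := by
    intro x
    by_cases hx : x ∈ S
    · simp only [hF', hG', if_pos hx]; exact key x hx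
    · simp [hF', hG', if_neg hx]
  have main := MeasureTheory.integral2_divergence_prod_of_hasFDerivAt_off_countable F G F' G'
    a 0 ε 1 ∅ countable_empty ?_ ?_ ?_ ?_ ?_
  · simp only [tot] at main
    simp only [hF, hG, hφ, one_smul, zero_smul, add_zero, add_sub_cancel] at main
    exact main
  · have k : Continuous (fun x : ℝ × ℝ => x.1 • (Q - P)) := by fun_prop
    exact (hVφ.fst.mul k.snd.continuousOn).sub (hVφ.snd.mul k.fst.continuousOn)
  · have k : Continuous (fun x : ℝ × ℝ => P + x.2 • (Q - P)) := by fun_prop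
    exact ((hVφ.fst.mul k.snd.continuousOn).sub (hVφ.snd.mul k.fst.continuousOn)).neg
  · rintro x ⟨hx, -⟩
    rw [min_eq_left hae, max_eq_right hae, min_eq_left zero_le_one, max_eq_right zero_le_one] at hx
    have hx' : x ∈ S := hx
    simp only [hF', if_pos hx']
    exact (hdF x hx').hasFDerivAt
  · rintro x ⟨hx, -⟩
    rw [min_eq_left hae, max_eq_right hae, min_eq_left zero_le_one, max_eq_right zero_le_one] at hx
    have hx' : x ∈ S := hx
    simp only [hG', if_pos hx']
    exact (hdG x hx').hasFDerivAt
  · simp only [tot]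
    apply ContinuousOn.integrableOn_compact
    · rw [u1, u2]; exact isCompact_Icc.prod isCompact_Icc
    · exact (continuous_const.mul continuous_fst).continuousOn.mul hdvφ

def nrm (w : ℝ × ℝ) : ℝ := Real.sqrt (w.1 ^ 2 + w.2 ^ 2)

def ee (θ : ℝ) : ℝ × ℝ := (Real.cos θ, Real.sin θ)

lemma nrm_nonneg (w : ℝ × ℝ) : 0 ≤ nrm w := Real.sqrt_nonneg _

lemma nrm_smul (s : ℝ) (hs : 0 ≤ s) (w : ℝ × ℝ) : nrm (s • w) = s * nrm w := by
  unfold nrm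
  have : (s • w).1 ^ 2 + (s • w).2 ^ 2 = s ^ 2 * (w.1 ^ 2 + w.2 ^ 2) := by
    simp; ring
  rw [this, Real.sqrt_mul (sq_nonneg s), Real.sqrt_sq hs]

lemma nrm_ee (θ : ℝ) : nrm (ee θ) = 1 := by
  simp [nrm, ee]

lemma sector_open (α δ : ℝ) (hα : α < π) : IsOpen (sector α δ) := by
  have h : sector α δ = polarCoord.symm '' (Ioo 0 δ ×ˢ Ioo (-α) α) := by
    ext p
    constructor
    · rintro ⟨r, θ, h1, h2, h3, h4, rfl⟩
      exact ⟨(r, θ), ⟨⟨h1, h2⟩, h3, h4⟩, by simp [polarCoord]⟩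
    · rintro ⟨⟨r, θ⟩, ⟨⟨h1, h2⟩, h3, h4⟩, rfl⟩
      exact ⟨r, θ, h1, h2, h3, h4, by simp [polarCoord]⟩
  rw [h]
  apply polarCoord.symm.isOpen_image_of_subset_source
  · exact isOpen_Ioo.prod isOpen_Ioo
  · rintro ⟨r, θ⟩ ⟨⟨h1, h2⟩, h3, h4⟩
    simp only [OpenPartialHomeomorph.symm_source, polarCoord_target]
    simp only at h1 h2 h3 h4
    refine ⟨h1, ?_, ?_⟩ <;> simp only <;> linarith

lemma Tf_crs_le (f : ℝ × ℝ → ℝ) (p w : ℝ × ℝ) : |crs (Tf f p) w| ≤ nrm w := by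
  unfold nrm
  apply Real.abs_le_sqrt
  unfold crs Tf
  set a := (grad f p).1
  set b := (grad f p).2
  have hpos : 0 < 1 + a ^ 2 + b ^ 2 := by positivity
  have hs : Real.sqrt (1 + a ^ 2 + b ^ 2) ^ 2 = 1 + a ^ 2 + b ^ 2 := Real.sq_sqrt hpos.le
  have hsp : 0 < Real.sqrt (1 + a ^ 2 + b ^ 2) := Real.sqrt_pos.2 hpos
  set S := Real.sqrt (1 + a ^ 2 + b ^ 2)
  have e : a / S * w.2 - b / S * w.1 = (a * w.2 - b * w.1) / S := by field_simp
  simp only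
  rw [e, div_pow, hs, div_le_iff₀ hpos]
  nlinarith [sq_nonneg (a * w.1 + b * w.2), sq_nonneg w.1, sq_nonneg w.2]

lemma Tf_dot_grad (f : ℝ × ℝ → ℝ) (p e : ℝ × ℝ) (he : e.1 ^ 2 + e.2 ^ 2 = 1) :
    (grad f p).1 * e.1 + (grad f p).2 * e.2 - 1 ≤ dot (Tf f p) (grad f p) := by
  unfold dot Tf
  set a := (grad f p).1
  set b := (grad f p).2
  have hpos : 0 < 1 + a ^ 2 + b ^ 2 := by positivity
  have hs : Real.sqrt (1 + a ^ 2 + b ^ 2) ^ 2 = 1 + a ^ 2 + b ^ 2 := Real.sq_sqrt hpos.le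
  have hsp : 0 < Real.sqrt (1 + a ^ 2 + b ^ 2) := Real.sqrt_pos.2 hpos
  have hs1 : 1 ≤ Real.sqrt (1 + a ^ 2 + b ^ 2) := by
    rw [Real.one_le_sqrt]; nlinarith [sq_nonneg a, sq_nonneg b]
  set S := Real.sqrt (1 + a ^ 2 + b ^ 2)
  have hle : a * e.1 + b * e.2 ≤ S := by
    refine (le_abs_self _).trans (abs_le_of_sq_le_sq ?_ hsp.le)
    rw [hs]
    nlinarith [sq_nonneg (a * e.2 - b * e.1)]
  have e1 : a / S * a + b / S * b = (a ^ 2 + b ^ 2) / S := by field_simp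
  simp only
  rw [e1, le_div_iff₀ hsp]
  have : a ^ 2 + b ^ 2 = S ^ 2 - 1 := by rw [hs]; ring
  rw [this]
  nlinarith

lemma grad_cont (f : ℝ × ℝ → ℝ) (p : ℝ × ℝ) (h : ContDiffAt ℝ 1 f p) :
    ContinuousAt (grad f) p := by
  have h1 : ContinuousAt (fderiv ℝ f) p := h.continuousAt_fderiv one_ne_zero
  exact (h1.clm_apply continuousAt_const).prodMk (h1.clm_apply continuousAt_const)

lemma Tf_cont (f : ℝ × ℝ → ℝ) (p : ℝ × ℝ) (h : ContDiffAt ℝ 1 f p) :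
    ContinuousAt (Tf f) p := by
  have h1 := grad_cont f p h
  have h2 : ContinuousAt (fun p => Real.sqrt (1 + (grad f p).1 ^ 2 + (grad f p).2 ^ 2)) p :=
    ((continuousAt_const.add (h1.fst.pow 2)).add (h1.snd.pow 2)).sqrt
  have h3 : Real.sqrt (1 + (grad f p).1 ^ 2 + (grad f p).2 ^ 2) ≠ 0 := by positivity
  exact (h1.fst.div h2 h3).prodMk (h1.snd.div h2 h3)

lemma Tf_diff (f : ℝ × ℝ → ℝ) (p : ℝ × ℝ) (h : ContDiffAt ℝ 2 f p) :
    DifferentiableAt ℝ (Tf f) p := by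
  have h1 : DifferentiableAt ℝ (fderiv ℝ f) p :=
    (h.fderiv_right (m := 1) (by norm_num)).differentiableAt one_ne_zero
  have h2 : DifferentiableAt ℝ (grad f) p :=
    (h1.clm_apply (differentiableAt_const _)).prodMk (h1.clm_apply (differentiableAt_const _))
  have h3 : (1 + (grad f p).1 ^ 2 + (grad f p).2 ^ 2) ≠ 0 := by positivity
  have h5 : Real.sqrt (1 + (grad f p).1 ^ 2 + (grad f p).2 ^ 2) ≠ 0 := by positivity
  have h6 : DifferentiableAt ℝ (fun p => 1 + (grad f p).1 ^ 2 + (grad f p).2 ^ 2) p := by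
    have := h2.fst
    have := h2.snd
    fun_prop
  have h4 := h6.sqrt h3
  have h7 := h2.fst
  have h8 := h2.snd
  have h9 := (h7.mul (h4.inv h5)).prodMk (h8.mul (h4.inv h5))
  unfold Tf
  simp only [div_eq_mul_inv]
  exact h9

lemma cone (θ₁ θ₂ b₁ b₂ t : ℝ) (h12 : θ₁ < θ₂) (hpi : θ₂ < θ₁ + π) (hb₁ : 0 < b₁) (hb₂ : 0 < b₂)
    (ht0 : 0 ≤ t) (ht1 : t ≤ 1) :
    ∃ ρ θ, 0 < ρ ∧ ρ ≤ b₁ + b₂ ∧ θ₁ ≤ θ ∧ θ ≤ θ₂ ∧ (t < 1 → θ < θ₂) ∧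
      b₁ • ee θ₁ + t • (b₂ • ee θ₂ - b₁ • ee θ₁) = ρ • ee θ := by
  set u := (1 - t) * b₁ with hu
  set v := t * b₂ with hv
  have hu0 : 0 ≤ u := mul_nonneg (by linarith) hb₁.le
  have hv0 : 0 ≤ v := mul_nonneg ht0 hb₂.le
  have hs : 0 < Real.sin (θ₂ - θ₁) := Real.sin_pos_of_pos_of_lt_pi (by linarith) (by linarith)
  have hivt : ∃ θ ∈ Icc θ₁ θ₂, u * Real.sin (θ - θ₁) - v * Real.sin (θ₂ - θ) = 0 := by
    have hc : ContinuousOn (fun θ => u * Real.sin (θ - θ₁) - v * Real.sin (θ₂ - θ)) (Icc θ₁ θ₂) := by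
      fun_prop
    apply intermediate_value_Icc h12.le hc
    constructor
    · simp; positivity
    · simp; positivity
  obtain ⟨θ, ⟨g1, g2⟩, g3⟩ := hivt
  have s1 : 0 ≤ Real.sin (θ - θ₁) := Real.sin_nonneg_of_nonneg_of_le_pi (by linarith) (by linarith)
  have s2 : 0 ≤ Real.sin (θ₂ - θ) := Real.sin_nonneg_of_nonneg_of_le_pi (by linarith) (by linarith)
  have hadd : Real.sin (θ₂ - θ₁) = Real.sin (θ₂ - θ) * Real.cos (θ - θ₁)
      + Real.cos (θ₂ - θ) * Real.sin (θ - θ₁) := by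
    rw [← Real.sin_add]; ring_nf
  set ρ := u * Real.cos (θ - θ₁) + v * Real.cos (θ₂ - θ) with hρ
  have r1 : ρ * Real.sin (θ₂ - θ) = u * Real.sin (θ₂ - θ₁) := by
    rw [hadd, hρ]; linear_combination (-Real.cos (θ₂ - θ)) * g3
  have r2 : ρ * Real.sin (θ - θ₁) = v * Real.sin (θ₂ - θ₁) := by
    rw [hadd, hρ]; linear_combination (Real.cos (θ - θ₁)) * g3
  have hρpos : 0 < ρ := by
    rcases lt_or_eq_of_le ht1 with h | h
    · have : 0 < u := mul_pos (by linarith) hb₁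
      have : 0 < ρ * Real.sin (θ₂ - θ) := by rw [r1]; positivity
      exact pos_of_mul_pos_left this s2
    · have : 0 < v := by rw [hv, h]; linarith
      have : 0 < ρ * Real.sin (θ - θ₁) := by rw [r2]; positivity
      exact pos_of_mul_pos_left this s1
  refine ⟨ρ, θ, hρpos, ?_, g1, g2, ?_, ?_⟩
  · have h1 : u * Real.cos (θ - θ₁) ≤ u * 1 := mul_le_mul_of_nonneg_left (Real.cos_le_one _) hu0
    have h2 : v * Real.cos (θ₂ - θ) ≤ v * 1 := mul_le_mul_of_nonneg_left (Real.cos_le_one _) hv0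
    have : u ≤ b₁ := by nlinarith
    have : v ≤ b₂ := by nlinarith
    linarith
  · intro h
    have : 0 < u := mul_pos (by linarith) hb₁
    have h3 : 0 < ρ * Real.sin (θ₂ - θ) := by rw [r1]; positivity
    rcases lt_or_eq_of_le g2 with h' | h'
    · exact h'
    · rw [h'] at h3; simp at h3
  · have hx : Real.cos θ ^ 2 + Real.sin θ ^ 2 = 1 := by rw [add_comm]; exact Real.sin_sq_add_cos_sq θ
    rw [Real.sin_sub, Real.sin_sub] at g3
    have hρ' : ρ = u * (Real.cos θ * Real.cos θ₁ + Real.sin θ * Real.sin θ₁)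
      + v * (Real.cos θ₂ * Real.cos θ + Real.sin θ₂ * Real.sin θ) := by
      rw [hρ, Real.cos_sub, Real.cos_sub]
    have key1 : u * Real.cos θ₁ + v * Real.cos θ₂ = ρ * Real.cos θ := by
      rw [hρ']
      linear_combination (-(u * Real.cos θ₁ + v * Real.cos θ₂)) * hx + Real.sin θ * g3
    have key2 : u * Real.sin θ₁ + v * Real.sin θ₂ = ρ * Real.sin θ := by
      rw [hρ']
      linear_combination (-(u * Real.sin θ₁ + v * Real.sin θ₂)) * hx - Real.cos θ * g3
    ext
    · simp [ee]; rw [← key1, hu, hv]; ring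
    · simp [ee]; rw [← key2, hu, hv]; ring

lemma par_int (h : ℝ × ℝ → ℝ) (a ε : ℝ) (hae : a ≤ ε)
    (hc : ContinuousOn h (Icc a ε ×ˢ Icc (0:ℝ) 1)) :
    IntervalIntegrable (fun s => ∫ t in (0:ℝ)..1, h (s, t)) volume a ε := by
  have h1 : IntegrableOn h (Icc a ε ×ˢ Icc (0:ℝ) 1) :=
    hc.integrableOn_compact (isCompact_Icc.prod isCompact_Icc)
  have h2 : IntegrableOn h (Ioc a ε ×ˢ Ioc (0:ℝ) 1) :=
    h1.mono_set (prod_mono Ioc_subset_Icc_self Ioc_subset_Icc_self)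
  rw [intervalIntegrable_iff_integrableOn_Ioc_of_le hae]
  simp only [intervalIntegral.integral_of_le (zero_le_one' ℝ)]
  rw [IntegrableOn, Measure.volume_eq_prod, ← Measure.prod_restrict] at h2
  exact h2.integral_prod_left

lemma sector_ee {α δ r θ : ℝ} (h0 : 0 < r) (h1 : r < δ) (h2 : -α < θ) (h3 : θ < α) :
    r • ee θ ∈ sector α δ := ⟨r, θ, h0, h1, h2, h3, by simp [ee]⟩

lemma seg_mem {α δ θ₁ θ₂ b₁ b₂ s t : ℝ} (h12 : θ₁ < θ₂) (hpi : θ₂ < θ₁ + π) (hb₁ : 0 < b₁)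
    (hb₂ : 0 < b₂) (ht : t ∈ Icc (0:ℝ) 1) (h1 : -α < θ₁) (h2 : θ₂ ≤ α) (h3 : t < 1 ∨ θ₂ < α)
    (hs : 0 < s) (hsδ : s * (b₁ + b₂) < δ) :
    s • (b₁ • ee θ₁ + t • (b₂ • ee θ₂ - b₁ • ee θ₁)) ∈ sector α δ := by
  obtain ⟨ρ, θ, g1, g2, g3, g4, g5, g6⟩ := cone θ₁ θ₂ b₁ b₂ t h12 hpi hb₁ hb₂ ht.1 ht.2
  rw [g6, smul_smul]
  apply sector_ee (by positivity)
  · nlinarith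
  · linarith
  · rcases h3 with h | h
    · linarith [g5 h]
    · linarith

lemma sol_cd2 {α δ κ lam₀ : ℝ} {γp γm : ℝ → ℝ} {f : ℝ × ℝ → ℝ} (hα : α < π)
    (hsol : IsCapillarySolution α δ κ lam₀ γp γm f) {p : ℝ × ℝ} (hp : p ∈ sector α δ) :
    ContDiffAt ℝ 2 f p :=
  hsol.smooth.contDiffAt ((sector_open α δ hα).mem_nhds hp)

lemma sol_cd1 {α δ κ lam₀ : ℝ} {γp γm : ℝ → ℝ} {f : ℝ × ℝ → ℝ} (hα : α < π)
    (hsol : IsCapillarySolution α δ κ lam₀ γp γm f) {p : ℝ × ℝ} (hp : p ∈ sector α δ) :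
    ContDiffAt ℝ 1 f p :=
  (sol_cd2 hα hsol hp).of_le (by norm_num)

lemma step1 {α δ κ lam₀ : ℝ} {γp γm : ℝ → ℝ} {f : ℝ × ℝ → ℝ} (hα : α < π)
    (hsol : IsCapillarySolution α δ κ lam₀ γp γm f) (K : ℝ)
    (hK : ∀ p ∈ sector α δ, |κ * f p + lam₀| ≤ K) (θ b a ε : ℝ) (h1 : -α < θ) (h2 : θ < α)
    (h3 : α < θ + π) (hb : 0 < b) (ha : 0 < a) (hae : a ≤ ε) (hε : ε * (1 + b) < δ) :
    (∫ s in a..ε, -crs (Tf f (s • ee θ)) (ee θ)) - (ε + a) * nrm (b • ee α - ee θ)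
      - |crs (ee θ) (b • ee α)| * K * ε ^ 2 ≤
    ∫ s in a..ε, -crs (Tf f (s • (b • ee α))) (b • ee α) := by
  have hcd : ∀ s ∈ Icc a ε, ∀ t ∈ Icc (0:ℝ) 1,
      ContDiffAt ℝ 1 f (s • (ee θ + t • (b • ee α - ee θ))) := by
    intro s hs t ht
    have hs0 : 0 < s := ha.trans_le hs.1
    have hsε : s * (1 + b) < δ := lt_of_le_of_lt (mul_le_mul_of_nonneg_right hs.2 (by linarith)) hε
    rcases lt_or_eq_of_le ht.2 with h | h
    · have := seg_mem (α := α) (δ := δ) h2 h3 one_pos hb ht h1 le_rfl (Or.inl h) hs0 hsε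
      rw [one_smul] at this
      exact sol_cd1 hα hsol this
    · have hx : s • (ee θ + t • (b • ee α - ee θ))
          = ((s * b) * Real.cos α, (s * b) * Real.sin α) := by
        rw [h]; ext <;> simp [ee] <;> ring
      rw [hx]
      refine hsol.edgeP_smooth (s * b) ⟨by positivity, by nlinarith⟩
  have hmem : ∀ s ∈ Icc a ε, ∀ t ∈ Ico (0:ℝ) 1,
      s • (ee θ + t • (b • ee α - ee θ)) ∈ sector α δ := by
    intro s hs t ht
    have hs0 : 0 < s := ha.trans_le hs.1
    have hsε : s * (1 + b) < δ := lt_of_le_of_lt (mul_le_mul_of_nonneg_right hs.2 (by linarith)) hε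
    have := seg_mem (α := α) (δ := δ) h2 h3 one_pos hb ⟨ht.1, ht.2.le⟩ h1 le_rfl (Or.inl ht.2) hs0 hsε
    rwa [one_smul] at this
  have key := flux_identity (Tf f) (fun p => κ * f p + lam₀) (ee θ) (b • ee α) a ε hae
    (fun s hs t ht => Tf_cont f _ (hcd s hs t ht))
    (fun s hs t ht => by
      have := (hcd s hs t ht).continuousAt
      fun_prop)
    (fun s hs t ht => Tf_diff f _ (sol_cd2 hα hsol
      (hmem s (Ioo_subset_Icc_self hs) t (Ioo_subset_Ico_self ht))))
    (fun s hs t ht => hsol.pde _ (hmem s (Ioo_subset_Icc_self hs) t (Ioo_subset_Ico_self ht)))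
  have hε0 : 0 < ε := ha.trans_le hae
  have hK0 : 0 ≤ K := (abs_nonneg _).trans (hK _ (hmem a ⟨le_rfl, hae⟩ 0 ⟨le_rfl, one_pos⟩))
  have bnd : ∀ r : ℝ, 0 ≤ r → |∫ t in (0:ℝ)..1,
      crs (Tf f (r • (ee θ + t • (b • ee α - ee θ)))) (r • (b • ee α - ee θ))|
        ≤ r * nrm (b • ee α - ee θ) := by
    intro r hr
    have := intervalIntegral.norm_integral_le_of_norm_le_const (a := (0:ℝ)) (b := 1)
      (f := fun t => crs (Tf f (r • (ee θ + t • (b • ee α - ee θ)))) (r • (b • ee α - ee θ)))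
      (C := r * nrm (b • ee α - ee θ)) (fun t _ => by
        rw [← nrm_smul r hr]; exact Tf_crs_le _ _ _)
    simpa using this
  have dbl : |∫ s in a..ε, ∫ t in (0:ℝ)..1, crs (ee θ) (b • ee α) * s *
      (κ * f (s • (ee θ + t • (b • ee α - ee θ))) + lam₀)|
      ≤ |crs (ee θ) (b • ee α)| * K * ε ^ 2 := by
    have h := intervalIntegral.norm_integral_le_of_norm_le_const (a := a) (b := ε)
      (f := fun s => ∫ t in (0:ℝ)..1, crs (ee θ) (b • ee α) * s *
      (κ * f (s • (ee θ + t • (b • ee α - ee θ))) + lam₀))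
      (C := |crs (ee θ) (b • ee α)| * ε * K) (fun s hs => by
        rw [uIoc_of_le hae] at hs
        have hs0 : 0 < s := ha.trans hs.1
        have h' := intervalIntegral.norm_integral_le_of_norm_le_const_ae (a := (0:ℝ)) (b := 1)
          (f := fun t => crs (ee θ) (b • ee α) * s *
            (κ * f (s • (ee θ + t • (b • ee α - ee θ))) + lam₀))
          (C := |crs (ee θ) (b • ee α)| * ε * K) (by
            have hne : ∀ᵐ t : ℝ, t ≠ 1 := by simp [ae_iff]
            filter_upwards [hne] with t ht ht'
            rw [uIoc_of_le zero_le_one] at ht'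
            rw [Real.norm_eq_abs, abs_mul, abs_mul, abs_of_pos hs0]
            have := hK _ (hmem s (Ioc_subset_Icc_self hs) t ⟨ht'.1.le, lt_of_le_of_ne ht'.2 ht⟩)
            have := hs.2
            gcongr)
        simpa using h')
    rw [Real.norm_eq_abs, abs_of_nonneg (sub_nonneg.2 hae)] at h
    refine h.trans ?_
    have : |crs (ee θ) (b • ee α)| * ε * K * (ε - a) ≤ |crs (ee θ) (b • ee α)| * ε * K * ε := by
      gcongr; linarith
    nlinarith
  have b1 := abs_le.1 (bnd ε hε0.le)
  have b2 := abs_le.1 (bnd a ha.le)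
  have b3 := abs_le.1 dbl
  linarith [b1.1, b1.2, b2.1, b2.2, b3.1, b3.2]

lemma div_smul_Tf (f : ℝ × ℝ → ℝ) (c : ℝ) (p : ℝ × ℝ) (h : ContDiffAt ℝ 2 f p) :
    fderiv ℝ (fun q => ((f q - c) • Tf f q).1) p (1, 0)
      + fderiv ℝ (fun q => ((f q - c) • Tf f q).2) p (0, 1)
      = dot (Tf f p) (grad f p) + (f p - c) * Nf f p := by
  have hT := Tf_diff f p h
  have hf : DifferentiableAt ℝ f p := h.differentiableAt two_ne_zero
  have hf' : DifferentiableAt ℝ (fun q => f q - c) p := hf.sub_const c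
  have h1 := fderiv_fun_mul hf' hT.fst
  have h2 := fderiv_fun_mul hf' hT.snd
  simp only [Prod.smul_fst, Prod.smul_snd, smul_eq_mul]
  rw [h1, h2]
  simp only [fderiv_sub_const, Nf, dot, grad, add_apply,
    smul_apply, smul_eq_mul]
  ring

lemma crs_smul (c : ℝ) (v w : ℝ × ℝ) : crs (c • v) w = c * crs v w := by
  simp [crs]; ring

lemma step2 {α δ κ lam₀ : ℝ} {γp γm : ℝ → ℝ} {f : ℝ × ℝ → ℝ} (hα : α < π)
    (hsol : IsCapillarySolution α δ κ lam₀ γp γm f) (K M c : ℝ)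
    (hK : ∀ p ∈ sector α δ, |κ * f p + lam₀| ≤ K) (hM : ∀ p ∈ sector α δ, |f p| ≤ M)
    (hc : |c| ≤ M)
    (θ₁ θ₂ a ε : ℝ) (h1 : -α < θ₁) (h12 : θ₁ < θ₂) (h2 : θ₂ < α)
    (h3 : θ₂ < θ₁ + π) (ha : 0 < a) (hae : a ≤ ε) (hε : ε * 2 < δ)
    (D L : ℝ) (hD : D = crs (ee θ₁) (ee θ₂)) (hL : L = nrm (ee θ₂ - ee θ₁))
    (hD0 : 0 < D) (hL0 : 0 < L) :
    (D / L) * (∫ s in a..ε, (f (s • ee θ₂) - f (s • ee θ₁))) - D * (1 + 2 * M * K) * ε ^ 2 ≤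
    (∫ s in a..ε, (f (s • ee θ₂) - c) * (-crs (Tf f (s • ee θ₂)) (ee θ₂)))
     - (∫ s in a..ε, (f (s • ee θ₁) - c) * (-crs (Tf f (s • ee θ₁)) (ee θ₁)))
     + ε * L * (∫ t in (0:ℝ)..1, |f (ε • (ee θ₁ + t • (ee θ₂ - ee θ₁))) - c|)
     + a * L * (2 * M) := by
  have hε0 : 0 < ε := ha.trans_le hae
  set P := ee θ₁ with hP
  set Q := ee θ₂ with hQ
  have hmem : ∀ s ∈ Icc a ε, ∀ t ∈ Icc (0:ℝ) 1, s • (P + t • (Q - P)) ∈ sector α δ := by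
    intro s hs t ht
    have hs0 : 0 < s := ha.trans_le hs.1
    have hsε : s * (1 + 1) < δ := by linarith [hs.2]
    have := seg_mem (α := α) (δ := δ) h12 h3 one_pos one_pos ht h1 h2.le (Or.inr h2) hs0 hsε
    rwa [one_smul, one_smul] at this
  have hcd2 := fun s hs t ht => sol_cd2 hα hsol (hmem s hs t ht)
  have hcd1 := fun s hs t ht => sol_cd1 hα hsol (hmem s hs t ht)
  have hM0 : 0 ≤ M := (abs_nonneg _).trans hc
  have hK0 : 0 ≤ K :=
    (abs_nonneg _).trans (hK _ (hmem a ⟨le_rfl, hae⟩ 0 ⟨le_rfl, zero_le_one⟩))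
  set dv : ℝ × ℝ → ℝ := fun p => dot (Tf f p) (grad f p) + (f p - c) * (κ * f p + lam₀) with hdv
  have hdvc : ∀ s ∈ Icc a ε, ∀ t ∈ Icc (0:ℝ) 1, ContinuousAt dv (s • (P + t • (Q - P))) := by
    intro s hs t ht
    have g1 := (hcd1 s hs t ht).continuousAt
    have g2 := Tf_cont f _ (hcd1 s hs t ht)
    have g3 := grad_cont f _ (hcd1 s hs t ht)
    exact ((g2.fst.mul g3.fst).add (g2.snd.mul g3.snd)).add
      ((g1.sub continuousAt_const).mul ((continuousAt_const.mul g1).add continuousAt_const))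
  have key := flux_identity (fun p => (f p - c) • Tf f p) dv P Q a ε hae
    (fun s hs t ht =>
      ((hcd1 s hs t ht).continuousAt.sub continuousAt_const).smul (Tf_cont f _ (hcd1 s hs t ht)))
    hdvc
    (fun s hs t ht =>
      DifferentiableAt.smul (((hcd1 s (Ioo_subset_Icc_self hs) t
        (Ioo_subset_Icc_self ht)).differentiableAt one_ne_zero).sub_const c) (Tf_diff f _ (hcd2 s (Ioo_subset_Icc_self hs) t
        (Ioo_subset_Icc_self ht))))
    (fun s hs t ht => by
      rw [div_smul_Tf f c _ (hcd2 s (Ioo_subset_Icc_self hs) t (Ioo_subset_Icc_self ht)),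
        hsol.pde _ (hmem s (Ioo_subset_Icc_self hs) t (Ioo_subset_Icc_self ht))])
  rw [← hD] at key
  -- the continuity on the rectangle
  set φ : ℝ × ℝ → ℝ × ℝ := fun x => x.1 • (P + x.2 • (Q - P)) with hφ
  have hφc : Continuous φ := by fun_prop
  have hdvφ : ContinuousOn (fun x => dv (φ x)) (Icc a ε ×ˢ Icc (0:ℝ) 1) := by
    rintro x ⟨g1, g2⟩
    have := (hdvc x.1 g1 x.2 g2)
    exact (ContinuousAt.comp (f := φ) (x := x) this hφc.continuousAt).continuousWithinAt
  have hLsq : L ^ 2 = (Q - P).1 ^ 2 + (Q - P).2 ^ 2 := by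
    rw [hL]; exact Real.sq_sqrt (by positivity)
  have inner : ∀ s ∈ Icc a ε, (D / L) * (f (s • Q) - f (s • P)) - D * (1 + 2 * M * K) * ε ≤
      ∫ t in (0:ℝ)..1, D * s * dv (s • (P + t • (Q - P))) := by
    intro s hs
    have hs0 : 0 < s := ha.trans_le hs.1
    have hline : Continuous (fun t : ℝ => s • (P + t • (Q - P))) := by fun_prop
    set q : ℝ → ℝ := fun t => (grad f (s • (P + t • (Q - P)))).1 * (s * (Q - P).1)
      + (grad f (s • (P + t • (Q - P)))).2 * (s * (Q - P).2) with hq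
    have hqc : ContinuousOn q (Icc 0 1) := by
      intro t ht
      have g3 := ContinuousAt.comp (f := fun t : ℝ => s • (P + t • (Q - P))) (x := t)
        (grad_cont f _ (hcd1 s hs t ht)) hline.continuousAt
      exact ((g3.fst.mul continuousAt_const).add
        (g3.snd.mul continuousAt_const)).continuousWithinAt
    have hFTC : ∫ t in (0:ℝ)..1, q t = f (s • Q) - f (s • P) := by
      have := intervalIntegral.integral_eq_sub_of_hasDerivAt (a := (0:ℝ)) (b := 1)
        (f := fun t => f (s • (P + t • (Q - P)))) (f' := q) (fun t ht => by
          rw [uIcc_of_le zero_le_one] at ht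
          have l2 : HasDerivAt (fun r : ℝ => s • (P + r • (Q - P))) (s • (Q - P)) t := by
            have := (((hasDerivAt_id t).smul_const (Q - P)).const_add P).const_smul s
            rw [one_smul] at this
            exact this
          have g := HasFDerivAt.comp_hasDerivAt (f := fun r : ℝ => s • (P + r • (Q - P))) t
            ((hcd1 s hs t ht).differentiableAt one_ne_zero).hasFDerivAt l2
          have hA : ∀ (A : ℝ × ℝ →L[ℝ] ℝ) (v : ℝ × ℝ),
              A v = A (1, 0) * v.1 + A (0, 1) * v.2 := by
            intro A v
            have : v = v.1 • ((1:ℝ), (0:ℝ)) + v.2 • ((0:ℝ), (1:ℝ)) := by ext <;> simp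
            conv_lhs => rw [this, map_add, map_smul, map_smul]
            simp; ring
          rw [hA] at g
          exact g)
        (ContinuousOn.intervalIntegrable (by rwa [uIcc_of_le zero_le_one]))
      rw [this]; simp
    have hmono : ∫ t in (0:ℝ)..1, ((D / L) * q t - D * (1 + 2 * M * K) * ε) ≤
        ∫ t in (0:ℝ)..1, D * s * dv (s • (P + t • (Q - P))) := by
      apply intervalIntegral.integral_mono_on zero_le_one
      · apply ContinuousOn.intervalIntegrable
        rw [uIcc_of_le zero_le_one]
        exact (continuousOn_const.mul hqc).sub continuousOn_const
      · apply ContinuousOn.intervalIntegrable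
        rw [uIcc_of_le zero_le_one]
        intro t ht
        exact (continuousAt_const.mul (ContinuousAt.comp
          (f := fun t : ℝ => s • (P + t • (Q - P))) (x := t)
          (hdvc s hs t ht) hline.continuousAt)).continuousWithinAt
      · intro t ht
        set p := s • (P + t • (Q - P)) with hp
        have hpm := hmem s hs t ht
        have g1 := Tf_dot_grad f p ((Q - P).1 / L, (Q - P).2 / L) (by
          simp only; rw [div_pow, div_pow, ← add_div, ← hLsq, div_self (by positivity)])
        have g2 : -(2 * M * K) ≤ (f p - c) * (κ * f p + lam₀) := by
          refine (abs_le.1 ?_).1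
          rw [abs_mul]
          have : |f p - c| ≤ 2 * M := (abs_sub _ _).trans (by linarith [hM p hpm])
          exact mul_le_mul this (hK p hpm) (abs_nonneg _) (by positivity)
        have g3 : (D / L) * q t = D * s * ((grad f p).1 * ((Q - P).1 / L)
            + (grad f p).2 * ((Q - P).2 / L)) := by
          simp only [hq, ← hp]; field_simp
        have g4 : D * (1 + 2 * M * K) * s ≤ D * (1 + 2 * M * K) * ε :=
          mul_le_mul_of_nonneg_left hs.2 (by positivity)
        have g5 : D * s * ((grad f p).1 * ((Q - P).1 / L)
            + (grad f p).2 * ((Q - P).2 / L) - 1 - 2 * M * K) ≤ D * s * dv p := by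
          apply mul_le_mul_of_nonneg_left _ (by positivity)
          simp only [hdv]; simp only at g1; linarith
        rw [g3]; linarith
    rw [intervalIntegral.integral_sub, intervalIntegral.integral_const_mul, hFTC] at hmono
    · simpa using hmono
    · apply ContinuousOn.intervalIntegrable
      rw [uIcc_of_le zero_le_one]
      exact (continuousOn_const.mul hqc)
    · simp
  have hray : ∀ θ, -α < θ → θ < α → ContinuousOn (fun s : ℝ => f (s • ee θ)) (Icc a ε) := by
    intro θ g1 g2 s hs
    have hs0 : 0 < s := ha.trans_le hs.1
    have hline : Continuous (fun s : ℝ => s • ee θ) := by fun_prop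
    have := (sol_cd1 hα hsol (sector_ee (δ := δ) hs0 (by linarith [hs.2]) g1 g2)).continuousAt
    exact (ContinuousAt.comp (f := fun s : ℝ => s • ee θ) (x := s) this
      hline.continuousAt).continuousWithinAt
  have hdiffc : ContinuousOn (fun s : ℝ => f (s • Q) - f (s • P)) (Icc a ε) :=
    (hray θ₂ (by linarith) h2).sub (hray θ₁ h1 (by linarith))
  have outer : ∫ s in a..ε, ((D / L) * (f (s • Q) - f (s • P)) - D * (1 + 2 * M * K) * ε) ≤
      ∫ s in a..ε, ∫ t in (0:ℝ)..1, D * s * dv (s • (P + t • (Q - P))) := by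
    apply intervalIntegral.integral_mono_on hae
    · apply ContinuousOn.intervalIntegrable
      rw [uIcc_of_le hae]
      exact (continuousOn_const.mul hdiffc).sub continuousOn_const
    · exact par_int (fun x => D * x.1 * dv (φ x)) a ε hae
        ((continuous_const.mul continuous_fst).continuousOn.mul hdvφ)
    · exact inner
  rw [intervalIntegral.integral_sub, intervalIntegral.integral_const_mul] at outer
  rotate_left
  · apply ContinuousOn.intervalIntegrable
    rw [uIcc_of_le hae]
    exact (continuousOn_const.mul hdiffc)
  · simp
  rw [intervalIntegral.integral_const, smul_eq_mul] at outer
  have o2 : (ε - a) * (D * (1 + 2 * M * K) * ε) ≤ D * (1 + 2 * M * K) * ε ^ 2 := by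
    have : 0 ≤ a * (D * (1 + 2 * M * K) * ε) := by positivity
    nlinarith
  simp only [crs_smul] at key
  have top : ∫ t in (0:ℝ)..1, (f (ε • (P + t • (Q - P))) - c) *
      crs (Tf f (ε • (P + t • (Q - P)))) (ε • (Q - P)) ≤
      ε * L * (∫ t in (0:ℝ)..1, |f (ε • (P + t • (Q - P))) - c|) := by
    have hline : Continuous (fun t : ℝ => ε • (P + t • (Q - P))) := by fun_prop
    have hfc : ContinuousOn (fun t : ℝ => f (ε • (P + t • (Q - P))) - c) (Icc 0 1) := by
      intro t ht
      exact ((ContinuousAt.comp (f := fun t : ℝ => ε • (P + t • (Q - P))) (x := t)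
        (hcd1 ε ⟨hae, le_rfl⟩ t ht).continuousAt hline.continuousAt).sub
        continuousAt_const).continuousWithinAt
    have hTc : ContinuousOn (fun t : ℝ => crs (Tf f (ε • (P + t • (Q - P)))) (ε • (Q - P)))
        (Icc 0 1) := by
      intro t ht
      have := (ContinuousAt.comp (f := fun t : ℝ => ε • (P + t • (Q - P))) (x := t)
        (Tf_cont f _ (hcd1 ε ⟨hae, le_rfl⟩ t ht)) hline.continuousAt)
      exact ((this.fst.mul continuousAt_const).sub
        (this.snd.mul continuousAt_const)).continuousWithinAt
    rw [← intervalIntegral.integral_const_mul]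
    apply intervalIntegral.integral_mono_on zero_le_one
    · apply ContinuousOn.intervalIntegrable
      rw [uIcc_of_le zero_le_one]
      exact hfc.mul hTc
    · apply ContinuousOn.intervalIntegrable
      rw [uIcc_of_le zero_le_one]
      exact continuousOn_const.mul hfc.abs
    · intro t ht
      refine (le_abs_self _).trans ?_
      rw [abs_mul, mul_comm]
      apply mul_le_mul_of_nonneg_right _ (abs_nonneg _)
      rw [hL, ← nrm_smul ε hε0.le]
      exact Tf_crs_le _ _ _
  have bot : |∫ t in (0:ℝ)..1, (f (a • (P + t • (Q - P))) - c) *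
      crs (Tf f (a • (P + t • (Q - P)))) (a • (Q - P))| ≤ a * L * (2 * M) := by
    have := intervalIntegral.norm_integral_le_of_norm_le_const (a := (0:ℝ)) (b := 1)
      (f := fun t => (f (a • (P + t • (Q - P))) - c) *
      crs (Tf f (a • (P + t • (Q - P)))) (a • (Q - P)))
      (C := a * L * (2 * M)) (fun t ht => by
        rw [uIoc_of_le zero_le_one] at ht
        rw [Real.norm_eq_abs, abs_mul, mul_comm (a * L)]
        have hpm := hmem a ⟨le_rfl, hae⟩ t (Ioc_subset_Icc_self ht)
        refine mul_le_mul ((abs_sub _ _).trans (by linarith [hM _ hpm])) ?_ (abs_nonneg _)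
          (by positivity)
        rw [hL, ← nrm_smul a ha.le]; exact Tf_crs_le _ _ _)
    simpa using this
  have b2 := abs_le.1 bot
  simp only [mul_neg]
  linarith [b2.1, b2.2]

lemma ev_lt (x : ℝ) (hx : 0 < x) : ∀ᶠ ε : ℝ in 𝓝[>] 0, 0 < ε ∧ ε < x := by
  filter_upwards [Ioo_mem_nhdsGT hx] with ε h using h

lemma radial_ee {f : ℝ × ℝ → ℝ} {θ L : ℝ} (h : RadialLimitAt f θ L) :
    Tendsto (fun r : ℝ => f (r • ee θ)) (𝓝[>] (0:ℝ)) (𝓝 L) := by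
  have : (fun r : ℝ => f (r • ee θ)) = fun r => f (r * Real.cos θ, r * Real.sin θ) := by
    ext r; simp [ee]
  rw [this]; exact h

lemma top_lim {α δ κ lam₀ : ℝ} {γp γm : ℝ → ℝ} {f : ℝ × ℝ → ℝ} (hα : α < π) (hδ : 0 < δ)
    (hsol : IsCapillarySolution α δ κ lam₀ γp γm f) (M : ℝ)
    (hM : ∀ p ∈ sector α δ, |f p| ≤ M) (R : ℝ → ℝ) (θ₁ θ₂ : ℝ)
    (h1 : -α < θ₁) (h12 : θ₁ < θ₂) (h2 : θ₂ < α) (h3 : θ₂ < θ₁ + π)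
    (hR : ∀ θ ∈ Icc θ₁ θ₂, RadialLimitAt f θ (R θ))
    (hmono : ∀ θ ∈ Icc θ₁ θ₂, R θ₁ ≤ R θ ∧ R θ ≤ R θ₂) (τ : ℝ) (hτ : 0 < τ) :
    ∀ᶠ ε : ℝ in 𝓝[>] 0, ∫ t in (0:ℝ)..1, |f (ε • (ee θ₁ + t • (ee θ₂ - ee θ₁))) - R θ₁|
      ≤ (R θ₂ - R θ₁) + τ := by
  set Δ := R θ₂ - R θ₁ with hΔ
  have hΔ0 : 0 ≤ Δ := by have := (hmono θ₂ ⟨h12.le, le_rfl⟩).1; linarith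
  have hmem : ∀ s : ℝ, 0 < s → s < δ / 2 → ∀ t ∈ Icc (0:ℝ) 1,
      s • (ee θ₁ + t • (ee θ₂ - ee θ₁)) ∈ sector α δ := by
    intro s hs hsδ t ht
    have hsε : s * (1 + 1) < δ := by linarith
    have := seg_mem (α := α) (δ := δ) h12 h3 one_pos one_pos ht h1 h2.le (Or.inr h2) hs hsε
    rwa [one_smul, one_smul] at this
  have hcont : ∀ s : ℝ, 0 < s → s < δ / 2 → 
      ContinuousOn (fun t : ℝ => |f (s • (ee θ₁ + t • (ee θ₂ - ee θ₁))) - R θ₁|) (Icc 0 1) := by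
    intro s hs hsδ t ht
    have hline : Continuous (fun t : ℝ => s • (ee θ₁ + t • (ee θ₂ - ee θ₁))) := by fun_prop
    exact ((ContinuousAt.comp (f := fun t : ℝ => s • (ee θ₁ + t • (ee θ₂ - ee θ₁))) (x := t)
        (sol_cd1 hα hsol (hmem s hs hsδ t ht)).continuousAt hline.continuousAt).sub
        continuousAt_const).abs.continuousWithinAt
  set H : ℝ → ℝ → ℝ := fun ε t =>
    max (|f (ε • (ee θ₁ + t • (ee θ₂ - ee θ₁))) - R θ₁| - Δ) 0 with hH
  have hHc : ∀ s : ℝ, 0 < s → s < δ / 2 → ContinuousOn (H s) (Icc 0 1) := fun s hs hsδ =>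
    ContinuousOn.sup ((hcont s hs hsδ).sub continuousOn_const) continuousOn_const
  have hM0 : 0 ≤ M := (abs_nonneg _).trans
    (hM _ (hmem (δ / 4) (by linarith) (by linarith) 0 ⟨le_rfl, zero_le_one⟩))
  have hlim : Tendsto (fun ε => ∫ t in (0:ℝ)..1, H ε t) (𝓝[>] 0)
      (𝓝 (∫ t in (0:ℝ)..1, (0:ℝ))) := by
    apply intervalIntegral.tendsto_integral_filter_of_dominated_convergence
      (fun _ => M + |R θ₁|)
    · filter_upwards [ev_lt (δ / 2) (by linarith)] with ε hε
      rw [uIoc_of_le zero_le_one]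
      exact ((hHc ε hε.1 hε.2).mono Ioc_subset_Icc_self).aestronglyMeasurable measurableSet_Ioc
    · filter_upwards [ev_lt (δ / 2) (by linarith)] with ε hε
      refine Eventually.of_forall fun t ht => ?_
      rw [uIoc_of_le zero_le_one] at ht
      have := hM _ (hmem ε hε.1 hε.2 t (Ioc_subset_Icc_self ht))
      rw [Real.norm_eq_abs, abs_of_nonneg (le_max_right _ _)]
      apply max_le
      · have := abs_sub (f (ε • (ee θ₁ + t • (ee θ₂ - ee θ₁)))) (R θ₁)
        linarith
      · positivity
    · simp
    · refine Eventually.of_forall fun t ht => ?_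
      rw [uIoc_of_le zero_le_one] at ht
      obtain ⟨ρ, θ, g1, g2, g3, g4, g5, g6⟩ := cone θ₁ θ₂ 1 1 t h12 h3 one_pos one_pos ht.1.le ht.2
      rw [one_smul, one_smul] at g6
      simp only [hH, g6, smul_smul]
      have k1 := radial_ee (hR θ ⟨g3, g4⟩)
      have k2 : Tendsto (fun ε : ℝ => ε * ρ) (𝓝[>] 0) (𝓝[>] 0) := by
        apply tendsto_nhdsWithin_iff.2
        constructor
        · have : Tendsto (fun ε : ℝ => ε * ρ) (𝓝 0) (𝓝 (0 * ρ)) :=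
            (continuous_id.mul continuous_const).tendsto 0
          rw [zero_mul] at this
          exact this.mono_left nhdsWithin_le_nhds
        · filter_upwards [self_mem_nhdsWithin] with ε hε
          exact mul_pos hε g1
      have k3 := (((k1.comp k2).sub_const (R θ₁)).abs.sub_const Δ).max
        (tendsto_const_nhds (x := (0:ℝ)))
      have hm := hmono θ ⟨g3, g4⟩
      have : max (|R θ - R θ₁| - Δ) 0 = 0 := by
        apply max_eq_right
        rw [abs_of_nonneg (by linarith)]; linarith
      rw [this] at k3
      exact k3
  simp only [intervalIntegral.integral_zero] at hlim
  filter_upwards [ev_lt (δ / 2) (by linarith), hlim.eventually (gt_mem_nhds hτ)] with ε hε hτε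
  have : ∫ t in (0:ℝ)..1, |f (ε • (ee θ₁ + t • (ee θ₂ - ee θ₁))) - R θ₁| ≤
      ∫ t in (0:ℝ)..1, (Δ + H ε t) := by
    apply intervalIntegral.integral_mono_on zero_le_one
    · apply ContinuousOn.intervalIntegrable
      rw [uIcc_of_le zero_le_one]; exact hcont ε hε.1 hε.2
    · apply ContinuousOn.intervalIntegrable
      rw [uIcc_of_le zero_le_one]; exact continuousOn_const.add (hHc ε hε.1 hε.2)
    · intro t ht
      have := le_max_left (|f (ε • (ee θ₁ + t • (ee θ₂ - ee θ₁))) - R θ₁| - Δ) 0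
      simp only [hH]; linarith
  rw [intervalIntegral.integral_add] at this
  · rw [intervalIntegral.integral_const, smul_eq_mul] at this
    linarith
  · simp
  · apply ContinuousOn.intervalIntegrable
    rw [uIcc_of_le zero_le_one]; exact (hHc ε hε.1 hε.2)

lemma arith2 {ε d L D M K Δ τ σ C F W X Y T : ℝ} (hε0 : 0 < ε) (hΔ0 : 0 < Δ)
    (hτ0 : 0 < τ) (hd0 : 0 < d) (hd1 : d ≤ 1) (hL0 : 0 < L) (hL2 : L ≤ 2)
    (hτ : τ = σ * Δ / 12) (hC : C = Δ + D * (1 + 2 * M * K) + 2 * M * L)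
    (S : d * W - D * (1 + 2 * M * K) * ε ^ 2 ≤ X - Y + ε * L * T + ε ^ 2 * L * (2 * M))
    (I1 : (ε - ε ^ 2) * (Δ - 2 * τ) ≤ W) (I2 : X ≤ Δ * F + τ * ε) (I3 : -(τ * ε) ≤ Y)
    (htop : T ≤ Δ + τ) (e4 : C * ε ≤ σ * Δ / 2) : ε * (d - L - σ) ≤ F := by
  have J1 : d * ((ε - ε ^ 2) * (Δ - 2 * τ)) ≤ d * W := mul_le_mul_of_nonneg_left I1 hd0.le
  have J2 : ε * L * T ≤ ε * L * (Δ + τ) := mul_le_mul_of_nonneg_left htop (by positivity)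
  have J3 : d * ε * Δ - ε ^ 2 * Δ - 2 * τ * ε ≤ d * ((ε - ε ^ 2) * (Δ - 2 * τ)) := by
    have q1 : d * (ε ^ 2 * Δ) ≤ 1 * (ε ^ 2 * Δ) := mul_le_mul_of_nonneg_right hd1 (by positivity)
    have q2 : d * (2 * τ * ε) ≤ 1 * (2 * τ * ε) := mul_le_mul_of_nonneg_right hd1 (by positivity)
    have q3 : 0 ≤ d * (2 * τ * ε ^ 2) := by positivity
    linarith
  have J4 : ε * L * τ ≤ ε * 2 * τ := by gcongr
  have J5 : ε * (C * ε) ≤ ε * (σ * Δ / 2) := mul_le_mul_of_nonneg_left e4 hε0.le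
  have fin : Δ * (ε * (d - L - σ)) ≤ Δ * F := by
    have e7 : 6 * τ * ε = σ * Δ / 2 * ε := by rw [hτ]; ring
    have e8 : ε * (C * ε) = ε ^ 2 * Δ + D * (1 + 2 * M * K) * ε ^ 2 + ε ^ 2 * L * (2 * M) := by
      rw [hC]; ring
    linarith
  exact le_of_mul_le_mul_left fin hΔ0

lemma arith1 {ε c s N h C b B F E I : ℝ} (hC : C = N + B + b)
    (hε0 : 0 < ε) (g1 : ε * (c - 2 * s - h / 2) ≤ F)
    (S1 : F - (ε + ε ^ 2) * N - B * ε ^ 2 ≤ E) (S2 : E ≤ I + b * ε ^ 2)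
    (e : C * ε ≤ h / 2) : ε * (c - 2 * s - N - h) ≤ I := by
  have J5 : ε * (C * ε) ≤ ε * (h / 2) := mul_le_mul_of_nonneg_left e hε0.le
  rw [hC] at J5
  linarith

lemma step2lim {α δ κ lam₀ : ℝ} {γp γm : ℝ → ℝ} {f : ℝ × ℝ → ℝ} (hα : α < π) (hδ : 0 < δ)
    (hsol : IsCapillarySolution α δ κ lam₀ γp γm f) (K M : ℝ)
    (hK : ∀ p ∈ sector α δ, |κ * f p + lam₀| ≤ K)
    (hM : ∀ p ∈ sector α δ, |f p| ≤ M) (R : ℝ → ℝ) (θ₁ θ₂ : ℝ)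
    (h1 : -α < θ₁) (h12 : θ₁ < θ₂) (h2 : θ₂ < α) (h3 : θ₂ < θ₁ + π)
    (hR : ∀ θ ∈ Icc θ₁ θ₂, RadialLimitAt f θ (R θ))
    (hmono : ∀ θ ∈ Icc θ₁ θ₂, R θ₁ ≤ R θ ∧ R θ ≤ R θ₂) (hlt : R θ₁ < R θ₂)
    (D L : ℝ) (hD : D = crs (ee θ₁) (ee θ₂)) (hL : L = nrm (ee θ₂ - ee θ₁))
    (hD0 : 0 < D) (hL0 : 0 < L) (hDL : D ≤ L) (hL2 : L ≤ 2) (σ : ℝ) (hσ : 0 < σ) :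
    ∀ᶠ ε : ℝ in 𝓝[>] 0, ε * (D / L - L - σ) ≤
      ∫ s in (ε ^ 2)..ε, -crs (Tf f (s • ee θ₂)) (ee θ₂) := by
  set Δ := R θ₂ - R θ₁ with hΔ
  have hΔ0 : 0 < Δ := by linarith
  have l1 := radial_ee (hR θ₁ ⟨le_rfl, h12.le⟩)
  have l2 := radial_ee (hR θ₂ ⟨h12.le, le_rfl⟩)
  have hc : |R θ₁| ≤ M := by
    refine le_of_tendsto l1.abs ?_
    filter_upwards [ev_lt δ hδ] with r hr
    exact hM _ (sector_ee hr.1 hr.2 h1 (by linarith))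
  have hM0 : 0 ≤ M := (abs_nonneg _).trans hc
  have hK0 : 0 ≤ K := (abs_nonneg _).trans
    (hK _ (sector_ee (r := δ / 2) (θ := θ₁) (by linarith) (by linarith) h1 (by linarith)))
  set τ := σ * Δ / 12 with hτ
  have hτ0 : 0 < τ := by positivity
  have m1 : ∀ᶠ r : ℝ in 𝓝[>] 0, |f (r • ee θ₁) - R θ₁| < τ := by
    have := l1.eventually (Metric.ball_mem_nhds _ hτ0)
    filter_upwards [this] with r hr
    simpa [Real.dist_eq] using hr
  have m2 : ∀ᶠ r : ℝ in 𝓝[>] 0, |f (r • ee θ₂) - R θ₂| < τ := by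
    have := l2.eventually (Metric.ball_mem_nhds _ hτ0)
    filter_upwards [this] with r hr
    simpa [Real.dist_eq] using hr
  obtain ⟨r₀, hr₀, hm⟩ := (mem_nhdsGT_iff_exists_Ioo_subset).1 (m1.and m2)
  set C := Δ + D * (1 + 2 * M * K) + 2 * M * L with hC
  have hC0 : 0 < C := by positivity
  filter_upwards [top_lim hα hδ hsol M hM R θ₁ θ₂ h1 h12 h2 h3 hR hmono τ hτ0,
    ev_lt (δ / 2) (by linarith), ev_lt 1 one_pos, ev_lt r₀ hr₀,
    ev_lt (σ * Δ / (2 * C)) (by positivity)] with ε htop e1 e2 e3 e4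
  have hε0 := e1.1
  have ha : 0 < ε ^ 2 := by positivity
  have hae : ε ^ 2 ≤ ε := by nlinarith
  have S := step2 hα hsol K M (R θ₁) hK hM hc θ₁ θ₂ (ε ^ 2) ε h1 h12 h2 h3 ha hae (by linarith)
    D L hD hL hD0 hL0
  have hray : ∀ θ, -α < θ → θ < α →
      ContinuousOn (fun s : ℝ => f (s • ee θ)) (Icc (ε ^ 2) ε) := by
    intro θ g1 g2 s hs
    have hs0 : 0 < s := ha.trans_le hs.1
    have hline : Continuous (fun s : ℝ => s • ee θ) := by fun_prop
    have := (sol_cd1 hα hsol (sector_ee (δ := δ) hs0 (by linarith [hs.2]) g1 g2)).continuousAt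
    exact (ContinuousAt.comp (f := fun s : ℝ => s • ee θ) (x := s) this
      hline.continuousAt).continuousWithinAt
  have hrayT : ∀ θ, -α < θ → θ < α →
      ContinuousOn (fun s : ℝ => -crs (Tf f (s • ee θ)) (ee θ)) (Icc (ε ^ 2) ε) := by
    intro θ g1 g2 s hs
    have hs0 : 0 < s := ha.trans_le hs.1
    have hline : Continuous (fun s : ℝ => s • ee θ) := by fun_prop
    have := Tf_cont f _ (sol_cd1 hα hsol (sector_ee (δ := δ) hs0 (by linarith [hs.2]) g1 g2))
    have := (ContinuousAt.comp (f := fun s : ℝ => s • ee θ) (x := s) this hline.continuousAt)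
    exact ((this.fst.mul continuousAt_const).sub
        (this.snd.mul continuousAt_const)).neg.continuousWithinAt
  have c1 := hray θ₁ h1 (by linarith)
  have c2 := hray θ₂ (by linarith) h2
  have T2 := hrayT θ₂ (by linarith) h2
  have ii : ∀ g : ℝ → ℝ, ContinuousOn g (Icc (ε ^ 2) ε) →
      IntervalIntegrable g volume (ε ^ 2) ε := fun g hg =>
    ContinuousOn.intervalIntegrable (by rwa [uIcc_of_le hae])
  have near : ∀ s ∈ Icc (ε ^ 2) ε, |f (s • ee θ₁) - R θ₁| < τ ∧ |f (s • ee θ₂) - R θ₂| < τ :=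
    fun s hs => hm ⟨ha.trans_le hs.1, lt_of_le_of_lt hs.2 e3.2⟩
  have I1 : (ε - ε ^ 2) * (Δ - 2 * τ) ≤ ∫ s in (ε ^ 2)..ε, (f (s • ee θ₂) - f (s • ee θ₁)) := by
    have : ∫ s in (ε ^ 2)..ε, (Δ - 2 * τ) ≤ ∫ s in (ε ^ 2)..ε, (f (s • ee θ₂) - f (s • ee θ₁)) := by
      apply intervalIntegral.integral_mono_on hae
      · simp
      · exact ii _ (c2.sub c1)
      · intro s hs
        have n1 := abs_lt.1 (near s hs).1
        have n2 := abs_lt.1 (near s hs).2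
        linarith [n1.1, n1.2, n2.1, n2.2]
    rwa [intervalIntegral.integral_const, smul_eq_mul] at this
  have tb : ∀ θ s : ℝ, |(-crs (Tf f (s • ee θ)) (ee θ))| ≤ 1 := by
    intro θ s
    rw [abs_neg]; have := Tf_crs_le f (s • ee θ) (ee θ); rwa [nrm_ee] at this
  have I2 : ∫ s in (ε ^ 2)..ε, (f (s • ee θ₂) - R θ₁) * (-crs (Tf f (s • ee θ₂)) (ee θ₂)) ≤
      Δ * (∫ s in (ε ^ 2)..ε, -crs (Tf f (s • ee θ₂)) (ee θ₂)) + τ * ε := by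
    have : ∫ s in (ε ^ 2)..ε, (f (s • ee θ₂) - R θ₁) * (-crs (Tf f (s • ee θ₂)) (ee θ₂)) ≤
        ∫ s in (ε ^ 2)..ε, (Δ * (-crs (Tf f (s • ee θ₂)) (ee θ₂)) + τ) := by
      apply intervalIntegral.integral_mono_on hae
      · exact ii _ ((c2.sub continuousOn_const).mul T2)
      · exact ii _ ((continuousOn_const.mul T2).add continuousOn_const)
      · intro s hs
        have n2 := (near s hs).2
        have n3 := tb θ₂ s
        have : (f (s • ee θ₂) - R θ₂) * (-crs (Tf f (s • ee θ₂)) (ee θ₂)) ≤ τ * 1 := by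
          refine (le_abs_self _).trans ?_
          rw [abs_mul]
          exact mul_le_mul n2.le n3 (abs_nonneg _) hτ0.le
        rw [hΔ]; linarith
    have hT2' : IntervalIntegrable (fun s : ℝ => Δ * (-crs (Tf f (s • ee θ₂)) (ee θ₂)))
        volume (ε ^ 2) ε := ii _ (continuousOn_const.mul T2)
    rw [intervalIntegral.integral_add hT2' intervalIntegrable_const,
      intervalIntegral.integral_const_mul, intervalIntegral.integral_const, smul_eq_mul] at this
    nlinarith
  have I3 : |∫ s in (ε ^ 2)..ε, (f (s • ee θ₁) - R θ₁) * (-crs (Tf f (s • ee θ₁)) (ee θ₁))| ≤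
      τ * ε := by
    have := intervalIntegral.norm_integral_le_of_norm_le_const (a := ε ^ 2) (b := ε)
      (f := fun s => (f (s • ee θ₁) - R θ₁) * (-crs (Tf f (s • ee θ₁)) (ee θ₁)))
      (C := τ * 1) (fun s hs => by
        rw [uIoc_of_le hae] at hs
        rw [Real.norm_eq_abs, abs_mul]
        exact mul_le_mul (near s (Ioc_subset_Icc_self hs)).1.le (tb _ _) (abs_nonneg _) hτ0.le)
    rw [Real.norm_eq_abs, abs_of_nonneg (sub_nonneg.2 hae)] at this
    nlinarith
  have I3' := (abs_le.1 I3).1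
  have hd1 : D / L ≤ 1 := by rw [div_le_one hL0]; exact hDL
  have e5 : C * ε ≤ σ * Δ / 2 := by
    have := e4.2.le
    rw [le_div_iff₀ (by positivity)] at this
    linarith
  exact arith2 hε0 hΔ0 hτ0 (div_pos hD0 hL0) hd1 hL0 hL2 hτ hC S I1 I2 I3' htop e5

lemma crs_ee (x y : ℝ) : crs (ee x) (ee y) = Real.sin (y - x) := by
  simp [crs, ee, Real.sin_sub]; ring

lemma nrm_ee_sub (x h : ℝ) (h0 : 0 ≤ h) (h1 : h ≤ π) :
    nrm (ee (x + h) - ee x) = 2 * Real.sin (h / 2) := by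
  have hs : 0 ≤ Real.sin (h / 2) := Real.sin_nonneg_of_nonneg_of_le_pi (by linarith) (by linarith)
  unfold nrm
  have h2 : Real.cos h = 1 - 2 * Real.sin (h / 2) ^ 2 := by
    have := Real.cos_two_mul (h / 2)
    rw [mul_div_cancel₀ _ two_ne_zero] at this
    rw [this]; nlinarith [Real.sin_sq_add_cos_sq (h / 2)]
  have h3 : (ee (x + h) - ee x).1 ^ 2 + (ee (x + h) - ee x).2 ^ 2 = (2 * Real.sin (h / 2)) ^ 2 := by
    have e : Real.cos h = Real.cos (x + h) * Real.cos x + Real.sin (x + h) * Real.sin x := by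
      rw [← Real.cos_sub]; ring_nf
    simp only [ee, Prod.fst_sub, Prod.snd_sub]
    rw [h2] at e
    nlinarith [Real.sin_sq_add_cos_sq (x + h), Real.sin_sq_add_cos_sq x]
  rw [h3, Real.sqrt_sq (by positivity)]

lemma edge_eq {α δ κ lam₀ : ℝ} {γp γm : ℝ → ℝ} {f : ℝ × ℝ → ℝ}
    (hsol : IsCapillarySolution α δ κ lam₀ γp γm f) (b a ε : ℝ) (hb : 0 < b) (ha : 0 < a)
    (hae : a ≤ ε) (hε : ε * (1 + b) < δ) :
    ∫ s in a..ε, -crs (Tf f (s • (b • ee α))) (b • ee α) ≤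
      (∫ t in Ioo (0:ℝ) (b * ε), Real.cos (γp t)) + b * a := by
  have hm : Measurable (fun t => Real.cos (γp t)) := Real.measurable_cos.comp hsol.measurable_γp
  have hi : ∀ x y, IntervalIntegrable (fun t => Real.cos (γp t)) volume x y := by
    intro x y
    refine (intervalIntegrable_const (c := (1:ℝ))).mono_fun hm.aestronglyMeasurable ?_
    refine Eventually.of_forall fun t => ?_
    simpa using Real.abs_cos_le_one _
  have e1 : ∫ s in a..ε, -crs (Tf f (s • (b • ee α))) (b • ee α) =
      ∫ s in a..ε, b * Real.cos (γp (b * s)) := by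
    apply intervalIntegral.integral_congr
    intro s hs
    rw [uIcc_of_le hae] at hs
    have hs0 : 0 < s := ha.trans_le hs.1
    have hbs : b * s < δ := by nlinarith [hs.2]
    have := hsol.bcP (b * s) ⟨by positivity, hbs⟩
    simp only
    rw [← this]
    have hx : s • (b • ee α) = ((b * s) * Real.cos α, (b * s) * Real.sin α) := by
      ext <;> simp [ee] <;> ring
    rw [hx]
    simp [crs, dot, ee]; ring
  have e2 : ∫ s in a..ε, b * Real.cos (γp (b * s)) = ∫ t in (b * a)..(b * ε), Real.cos (γp t) := by
    rw [intervalIntegral.integral_const_mul]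
    exact intervalIntegral.mul_integral_comp_mul_left (f := fun t => Real.cos (γp t)) b
  have e3 : ∫ t in Ioo (0:ℝ) (b * ε), Real.cos (γp t) = ∫ t in (0:ℝ)..(b * ε), Real.cos (γp t) := by
    rw [intervalIntegral.integral_of_le (by nlinarith), integral_Ioc_eq_integral_Ioo]
  have e4 := intervalIntegral.integral_add_adjacent_intervals (hi 0 (b * a)) (hi (b * a) (b * ε))
  have e5 := intervalIntegral.norm_integral_le_of_norm_le_const (a := (0:ℝ)) (b := b * a)
    (f := fun t => Real.cos (γp t)) (C := 1) (fun t _ => Real.abs_cos_le_one _)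
  rw [Real.norm_eq_abs, sub_zero, abs_of_pos (by positivity : 0 < b * a), one_mul] at e5
  have e6 := (abs_le.1 e5).1
  rw [e1, e2, e3, ← e4]
  linarith


lemma tri_side (α α₂ lam : ℝ) (hs : 0 < Real.sin lam) (hβ : 0 ≤ Real.sin (α - α₂)) :
    nrm ((Real.sin (lam - (α - α₂)) / Real.sin lam) • ee α - ee α₂)
      = Real.sin (α - α₂) / Real.sin lam := by
  set β := α - α₂ with hβd
  have hα : α = α₂ + β := by rw [hβd]; ring
  unfold nrm
  have h3 : (((Real.sin (lam - β) / Real.sin lam) • ee α - ee α₂).1 ^ 2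
      + ((Real.sin (lam - β) / Real.sin lam) • ee α - ee α₂).2 ^ 2)
        = (Real.sin β / Real.sin lam) ^ 2 := by
    set b := Real.sin (lam - β) / Real.sin lam with hb
    have hbs : b * Real.sin lam = Real.sin (lam - β) := by rw [hb]; field_simp
    have e : Real.cos β = Real.cos α * Real.cos α₂ + Real.sin α * Real.sin α₂ := by
      rw [hβd, Real.cos_sub]
    have k1 : (b • ee α - ee α₂).1 ^ 2 + (b • ee α - ee α₂).2 ^ 2 = b ^ 2 + 1 - 2 * b * Real.cos β := by
      simp only [ee, Prod.fst_sub, Prod.snd_sub, Prod.smul_fst, Prod.smul_snd, smul_eq_mul]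
      rw [e]
      linear_combination b ^ 2 * Real.sin_sq_add_cos_sq α + Real.sin_sq_add_cos_sq α₂
    rw [k1, div_pow (Real.sin β), eq_div_iff (by positivity)]
    rw [Real.sin_sub] at hbs
    have k2 : (b ^ 2 + 1 - 2 * b * Real.cos β) * Real.sin lam ^ 2 =
      (b * Real.sin lam) ^ 2 + Real.sin lam ^ 2 - 2 * (b * Real.sin lam) * Real.cos β * Real.sin lam := by
      ring
    rw [k2, hbs]
    linear_combination (-Real.sin lam ^ 2) * Real.sin_sq_add_cos_sq β + Real.sin β ^ 2 * Real.sin_sq_add_cos_sq lam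
  rw [h3, Real.sqrt_sq (by positivity)]

lemma psi_cont (α α₂ b : ℝ) : Continuous (fun h : ℝ => Real.cos (h / 2) - 2 * Real.sin (h / 2)
      - nrm (b • ee α - ee (α₂ - h)) - h) := by
  have h1 : Continuous (fun h : ℝ => ee (α₂ - h)) :=
    (Real.continuous_cos.comp (continuous_const.sub continuous_id)).prodMk
      (Real.continuous_sin.comp (continuous_const.sub continuous_id))
  have h2 : Continuous (fun h : ℝ => b • ee α - ee (α₂ - h)) := continuous_const.sub h1
  have h3 : Continuous (fun h : ℝ => nrm (b • ee α - ee (α₂ - h))) :=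
    ((h2.fst.pow 2).add (h2.snd.pow 2)).sqrt
  have h4 : Continuous (fun h : ℝ => Real.cos (h / 2) - 2 * Real.sin (h / 2)) := by fun_prop
  exact (h4.sub h3).sub continuous_id

/-- Lower bound for an increasing upper side fan: if `Rf` is constant on
`[α₂, α)` and strictly increasing on `[α₂ − η, α₂] ∩ (−α, α)`, then with `β⁺ = α − α₂`,
for every `λ ∈ (β⁺, π)` one has
`A⁺_I(sin(λ−β⁺)/sin λ) + sin β⁺ / sin λ ≥ 1`. -/
theorem upper_fan_increasing_bound
    (α δ κ lam₀ : ℝ) (γp γm : ℝ → ℝ) (f : ℝ × ℝ → ℝ) (R : ℝ → ℝ)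
    (hα : α ∈ Ioo 0 π) (hδ : 0 < δ)
    (hsol : IsCapillarySolution α δ κ lam₀ γp γm f)
    (hdisc : DiscontinuousAtCorner α δ f)
    (hR : ∀ θ ∈ Ioo (-α) α, RadialLimitAt f θ (R θ))
    (α₂ η : ℝ) (hα₂ : α₂ ∈ Ioc (-α) α) (hη : 0 < η)
    (hconst : ∃ c : ℝ, ∀ θ ∈ Ico α₂ α, R θ = c)
    (hmono : StrictMonoOn R (Icc (α₂ - η) α₂ ∩ Ioo (-α) α)) :
    ∀ lam ∈ Ioo (α - α₂) π,
      1 ≤ fanAI γp (Real.sin (lam - (α - α₂)) / Real.sin lam) +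
        Real.sin (α - α₂) / Real.sin lam := by
  intro lam hlam
  obtain ⟨hα0, hαπ⟩ := hα
  obtain ⟨hα₂1, hα₂2⟩ := hα₂
  have hβ0 : 0 ≤ α - α₂ := by linarith
  have hlam0 : 0 < lam := by linarith [hlam.1]
  have hsl : 0 < Real.sin lam := Real.sin_pos_of_pos_of_lt_pi hlam0 hlam.2
  have hsb : 0 < Real.sin (lam - (α - α₂)) :=
    Real.sin_pos_of_pos_of_lt_pi (by linarith [hlam.1]) (by linarith [hlam.2])
  have hsβ : 0 ≤ Real.sin (α - α₂) :=
    Real.sin_nonneg_of_nonneg_of_le_pi hβ0 (by linarith [hlam.1, hlam.2])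
  rw [← tri_side α α₂ lam hsl hsβ]
  have hb : 0 < Real.sin (lam - (α - α₂)) / Real.sin lam := by positivity
  set b := Real.sin (lam - (α - α₂)) / Real.sin lam with hbdef
  obtain ⟨M, hM⟩ := hsol.bounded
  obtain ⟨K, hK⟩ : ∃ K, ∀ p ∈ sector α δ, |κ * f p + lam₀| ≤ K := by
    refine ⟨|κ| * M + |lam₀|, fun p hp => (abs_add_le _ _).trans ?_⟩
    rw [abs_mul]
    have := mul_le_mul_of_nonneg_left (hM p hp) (abs_nonneg κ)
    linarith
  have hK0 : 0 ≤ K := (abs_nonneg _).trans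
    (hK _ (sector_ee (r := δ / 2) (θ := 0) (by linarith) (by linarith) (by linarith) hα0))
  have main : ∀ᶠ h : ℝ in 𝓝[>] 0, Real.cos (h / 2) - 2 * Real.sin (h / 2)
      - nrm (b • ee α - ee (α₂ - h)) - h ≤ fanAI γp b := by
    filter_upwards [ev_lt (η / 2) (by linarith), ev_lt ((α₂ + α) / 2) (by linarith),
      ev_lt (π - (α - α₂)) (by linarith [hlam.1, hlam.2]), ev_lt 1 one_pos] with h e1 e2 e3 e4
    have hh := e1.1
    have hpi3 := Real.pi_gt_three
    set θ₁ := α₂ - 2 * h with hθ₁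
    set θ₂ := α₂ - h with hθ₂
    have a1 : -α < θ₁ := by rw [hθ₁]; linarith
    have a12 : θ₁ < θ₂ := by rw [hθ₁, hθ₂]; linarith
    have a2 : θ₂ < α := by rw [hθ₂]; linarith
    have a3 : θ₂ < θ₁ + π := by rw [hθ₁, hθ₂]; linarith
    have hin : ∀ θ ∈ Icc θ₁ θ₂, θ ∈ Icc (α₂ - η) α₂ ∩ Ioo (-α) α := by
      intro θ hθ
      refine ⟨⟨?_, ?_⟩, ?_, ?_⟩
      · linarith [hθ.1]
      · linarith [hθ.2]
      · linarith [hθ.1]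
      · linarith [hθ.2]
    have hD : Real.sin h = crs (ee θ₁) (ee θ₂) := by
      rw [crs_ee]; congr 1; rw [hθ₁, hθ₂]; ring
    have hL : 2 * Real.sin (h / 2) = nrm (ee θ₂ - ee θ₁) := by
      rw [← nrm_ee_sub θ₁ h hh.le (by linarith)]
      congr 3; rw [hθ₁, hθ₂]; ring
    have hs2 : 0 < Real.sin (h / 2) :=
      Real.sin_pos_of_pos_of_lt_pi (by linarith) (by linarith)
    have hD0 : 0 < Real.sin h := Real.sin_pos_of_pos_of_lt_pi hh (by linarith)
    have hdbl : Real.sin h = 2 * Real.sin (h / 2) * Real.cos (h / 2) := by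
      rw [← Real.sin_two_mul]; congr 1; ring
    have hDL : Real.sin h ≤ 2 * Real.sin (h / 2) := by
      rw [hdbl]; nlinarith [Real.cos_le_one (h / 2)]
    have hquot : Real.sin h / (2 * Real.sin (h / 2)) = Real.cos (h / 2) := by
      rw [hdbl]; field_simp
    have F2 := step2lim hαπ hδ hsol K M hK hM R θ₁ θ₂ a1 a12 a2 a3
      (fun θ hθ => hR θ (hin θ hθ).2)
      (fun θ hθ => ⟨hmono.monotoneOn (hin θ₁ ⟨le_rfl, a12.le⟩) (hin θ hθ) hθ.1,
        hmono.monotoneOn (hin θ hθ) (hin θ₂ ⟨a12.le, le_rfl⟩) hθ.2⟩)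
      (hmono (hin θ₁ ⟨le_rfl, a12.le⟩) (hin θ₂ ⟨a12.le, le_rfl⟩) a12)
      (Real.sin h) (2 * Real.sin (h / 2)) hD hL hD0 (by positivity) hDL
      (by linarith [Real.sin_le_one (h / 2)]) (h / 2) (by positivity)
    rw [hquot] at F2
    set N := nrm (b • ee α - ee θ₂) with hN
    have hN0 : 0 ≤ N := nrm_nonneg _
    set C := N + |crs (ee θ₂) (b • ee α)| * K + b with hC
    have hC0 : 0 < C := by positivity
    unfold fanAI
    apply le_liminf_of_le
    · apply Filter.IsBoundedUnder.isCoboundedUnder_ge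
      refine ⟨b, ?_⟩
      rw [eventually_map]
      filter_upwards [ev_lt 1 one_pos] with ε hε
      have := norm_setIntegral_le_of_norm_le_const (μ := volume) (s := Ioo (0:ℝ) (b * ε))
        (f := fun t => Real.cos (γp t)) (C := 1) (by simp)
        (fun t _ => Real.abs_cos_le_one _)
      have hbε : 0 ≤ b * ε := mul_nonneg hb.le hε.1.le
      simp only [Measure.real, Real.volume_Ioo, sub_zero, ENNReal.toReal_ofReal hbε, one_mul,
        Real.norm_eq_abs] at this
      have h3 := (le_abs_self _).trans this
      rw [inv_mul_le_iff₀ hε.1]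
      linarith
    · filter_upwards [F2, ev_lt (δ / (1 + b)) (by positivity), ev_lt 1 one_pos,
        ev_lt (h / (2 * C)) (by positivity)] with ε g1 g2 g3 g4
      have hε0 := g2.1
      have ha : 0 < ε ^ 2 := by positivity
      have hae : ε ^ 2 ≤ ε := by nlinarith [g3.2]
      have hεδ : ε * (1 + b) < δ := by
        have := g2.2; rwa [lt_div_iff₀ (by positivity)] at this
      have S1 := step1 hαπ hsol K hK θ₂ b (ε ^ 2) ε (by linarith) a2
        (by rw [hθ₂]; linarith [e3.2]) hb ha hae hεδ
      have S2 := edge_eq hsol b (ε ^ 2) ε hb ha hae hεδ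
      rw [← hN] at S1
      have e9 : C * ε ≤ h / 2 := by
        have := g4.2.le
        rw [le_div_iff₀ (by positivity)] at this
        linarith
      rw [le_inv_mul_iff₀ hε0]
      exact arith1 hC hε0 g1 S1 S2 e9
  have hlim : Tendsto (fun h : ℝ => Real.cos (h / 2) - 2 * Real.sin (h / 2)
      - nrm (b • ee α - ee (α₂ - h)) - h) (𝓝[>] 0) (𝓝 (1 - nrm (b • ee α - ee α₂))) := by
    have hc := psi_cont α α₂ b
    have := hc.tendsto 0
    simp only [zero_div, Real.cos_zero, Real.sin_zero, mul_zero, sub_zero] at this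
    exact this.mono_left nhdsWithin_le_nhds
  have := le_of_tendsto hlim main
  linarith
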